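/- arXiv:2511.23472 — 4 statements merged into one kernel-verified Lean document; each statement's English description precedes it below -/
import Mathlib

section
/- Equivalence of the operational and denotational semantics: let c = (C̄, ψ, S) be a configuration. (i) Every configuration reachable from c by the small-step reduction whose command sequence is nonempty is reducible (i.e. c never gets stuck in any branch) if and only if the behaviour tree t = ⟦C̄⟧(ψ, S) is defined. (ii) If t is defined, then for every finite sequence ī of measurement labels, c reduces in finitely many steps to a terminal configuration (ε, φ, S') with labelled steps exactly ī in order if and only if t.ī = Leaf(φ, S'), where t.ī denotes iterated child access along ī. -/
open scoped Classical

noncomputable section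

namespace QSL

/-! ## Resources -/

/-- Vectors over the Hilbert space with orthonormal basis indexed by `Q → {0,1}`. -/
def Vec {Qubit : Type} (Q : Finset Qubit) : Type := ({ q // q ∈ Q } → Bool) → ℂ

/-- A quantum state: a finite set of qubits together with a vector over them. -/
def QState (Qubit : Type) : Type := Σ Q : Finset Qubit, Vec Q

/-- A store: a partial function from variables to values. -/
def Store (Var Val : Type) : Type := Var → Option Val

/-- A resource: a quantum state together with a store. -/
def Res (Qubit Var Val : Type) : Type := QState Qubit × Store Var Val

variable {Qubit Var Val : Type}

/-- Tensor product of vectors over disjoint qubit sets. -/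
def tensorVec {Q Q' : Finset Qubit} (v : Vec Q) (w : Vec Q') : Vec (Q ∪ Q') := fun f =>
  v (fun q => f ⟨q.1, Finset.mem_union_left _ q.2⟩) *
  w (fun q => f ⟨q.1, Finset.mem_union_right _ q.2⟩)

/-- Transport of a vector along an equality of qubit sets. -/
def castVec {Q Q' : Finset Qubit} (h : Q = Q') (v : Vec Q) : Vec Q' := h ▸ v

/-- The empty quantum state with scalar 1. -/
def unitQ : QState Qubit := ⟨(∅ : Finset Qubit), fun _ => 1⟩

/-- The unit resource: empty qubit set with scalar 1 and the empty store. -/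
def unitRes : Res Qubit Var Val := (unitQ, fun _ => none)

/-- Partial product of resources: defined iff the qubit sets are disjoint and
the store domains are disjoint; takes the union of qubit sets, tensor product of
vectors, and union of stores. -/
def rmul (a b : Res Qubit Var Val) : Option (Res Qubit Var Val) :=
  if h : Disjoint a.1.1 b.1.1 ∧ ∀ x, a.2 x = none ∨ b.2 x = none then
    some (⟨a.1.1 ∪ b.1.1, tensorVec a.1.2 b.1.2⟩, fun x => a.2 x <|> b.2 x)
  else none

/-- Partial sum of resources: defined iff the two resources have the same
qubit set and the same store; adds the vectors. -/
def radd (a b : Res Qubit Var Val) : Option (Res Qubit Var Val) :=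
  if h : a.1.1 = b.1.1 ∧ a.2 = b.2 then
    some (⟨b.1.1, fun f => castVec h.1 a.1.2 f + b.1.2 f⟩, b.2)
  else none

/-- Incompatibility of resources: some variable lies in both store domains and
the stores disagree on it. -/
def incompat (a b : Res Qubit Var Val) : Prop :=
  ∃ x u u', a.2 x = some u ∧ b.2 x = some u' ∧ u ≠ u'

/-! ## The programming language (values are natural numbers) -/

/-- Pure expressions: constants, variables, operations applied to subexpressions. -/
inductive Expr (Var : Type) : Type
  | const : ℕ → Expr Var
  | evar : Var → Expr Var
  | op : (n : ℕ) → ((Fin n → ℕ) → ℕ) → (Fin n → Expr Var) → Expr Var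

/-- Evaluation of a pure expression in a store; undefined on variables outside
the store's domain. -/
def Expr.eval {Var : Type} (S : Store Var ℕ) : Expr Var → Option ℕ
  | .const n => some n
  | .evar x => S x
  | .op n f es =>
      if h : ∀ i, (Expr.eval S (es i)).isSome then
        some (f (fun i => (Expr.eval S (es i)).get (h i)))
      else none

/-- A unitary operator on `n` qubits, as a matrix with orthonormal columns. -/
structure UnitaryOp (n : ℕ) : Type where
  mat : (Fin n → Bool) → (Fin n → Bool) → ℂ
  unitary : ∀ a b, (∑ c : Fin n → Bool, (starRingEnd ℂ) (mat c a) * mat c b) =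
    if a = b then 1 else 0

/-- A measurement: a finite family of linear operators `M⁽ⁱ⁾` on `n` qubits
with `Σᵢ (M⁽ⁱ⁾)† M⁽ⁱ⁾ = I`. -/
structure MeasOp (k n : ℕ) : Type where
  ops : Fin k → (Fin n → Bool) → (Fin n → Bool) → ℂ
  complete : ∀ a b,
    (∑ i : Fin k, ∑ c : Fin n → Bool, (starRingEnd ℂ) (ops i c a) * ops i c b) =
      if a = b then 1 else 0


/-- Apply an operator (given by its matrix) to the designated qubits of a
quantum state; defined iff the designated qubits are distinct and all present. -/
def applyOp {n : ℕ} (mat : (Fin n → Bool) → (Fin n → Bool) → ℂ) (qs : Fin n → Qubit)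
    (ψ : QState Qubit) : Option (QState Qubit) :=
  if h : Function.Injective qs ∧ ∀ i, qs i ∈ ψ.1 then
    some ⟨ψ.1, fun g => ∑ b : Fin n → Bool,
      mat (fun i => g ⟨qs i, h.2 i⟩) b *
      ψ.2 (fun q => if h' : ∃ i, qs i = q.1 then b h'.choose else g q)⟩
  else none

/-- Commands of the language. -/
inductive Cmd (Qubit Var : Type) : Type
  | skip
  | seq (c c' : Cmd Qubit Var)
  | ite (e : Expr Var) (c1 c0 : Cmd Qubit Var)
  | whileC (e : Expr Var) (c : Cmd Qubit Var)
  | assign (x : Var) (e : Expr Var)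
  | unitary (n : ℕ) (U : UnitaryOp n) (qs : Fin n → Qubit)
  | measure (x : Var) (k n : ℕ) (M : MeasOp k n) (qs : Fin n → Qubit)

/-! ## Behaviour trees (represented as partial labelling functions on paths) -/

/-- Node labels of behaviour trees. -/
inductive BLabel (Qubit Var : Type) : Type
  | branch (k : ℕ)
  | leaf (a : Res Qubit Var ℕ)
  | nil

/-- Behaviour trees, represented by their partial labelling function on paths. -/
def BTree (Qubit Var : Type) : Type := List ℕ → Option (BLabel Qubit Var)

/-- The tree `Nil`. -/
def nilTree : BTree Qubit Var := fun p => if p = [] then some BLabel.nil else none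

/-- The tree `Leaf a`. -/
def leafTree (a : Res Qubit Var ℕ) : BTree Qubit Var :=
  fun p => if p = [] then some (BLabel.leaf a) else none

/-- The tree `Branch` with `k` children. -/
def branchTree (k : ℕ) (child : Fin k → BTree Qubit Var) : BTree Qubit Var := fun p =>
  match p with
  | [] => some (BLabel.branch k)
  | i :: p' => if h : i < k then child ⟨i, h⟩ p' else none

/-- Iterated child access `t.ī`. -/
def BTree.access (t : BTree Qubit Var) (is : List ℕ) : BTree Qubit Var :=
  fun p => t (is ++ p)

/-- Branching of partially-defined children: defined iff all children are. -/
def branchOpt (k : ℕ) (f : Fin k → Option (BTree Qubit Var)) : Option (BTree Qubit Var) :=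
  if h : ∀ i, (f i).isSome then some (branchTree k (fun i => (f i).get (h i))) else none

/-- Store update. -/
def updStore (S : Store Var ℕ) (x : Var) (v : ℕ) : Store Var ℕ :=
  fun y => if y = x then some v else S y

/-! ## Denotational semantics -/

/-- The `n`-th approximation of the denotational semantics, rendering
computations unfinished after `n` unfolding steps as `Nil`. -/
def semN : ℕ → List (Cmd Qubit Var) → QState Qubit → Store Var ℕ → Option (BTree Qubit Var)
  | 0, _, _, _ => some nilTree
  | _ + 1, [], ψ, S => some (leafTree (ψ, S))
  | n + 1, Cmd.skip :: cs, ψ, S => semN n cs ψ S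
  | n + 1, Cmd.seq c c' :: cs, ψ, S => semN n (c :: c' :: cs) ψ S
  | n + 1, Cmd.ite e c1 c0 :: cs, ψ, S =>
      match Expr.eval S e with
      | some 1 => semN n (c1 :: cs) ψ S
      | some 0 => semN n (c0 :: cs) ψ S
      | _ => none
  | n + 1, Cmd.whileC e c :: cs, ψ, S =>
      semN n (Cmd.ite e (Cmd.seq c (Cmd.whileC e c)) Cmd.skip :: cs) ψ S
  | n + 1, Cmd.assign x e :: cs, ψ, S =>
      match S x, Expr.eval S e with
      | some _, some v => semN n cs ψ (updStore S x v)
      | _, _ => none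
  | n + 1, Cmd.unitary nq U qs :: cs, ψ, S =>
      match applyOp U.mat qs ψ with
      | some ψ' => semN n cs ψ' S
      | none => none
  | n + 1, Cmd.measure x k nq M qs :: cs, ψ, S =>
      match S x with
      | some _ =>
          branchOpt k (fun i =>
            (applyOp (M.ops i) qs ψ).bind (fun ψ' => semN n cs ψ' (updStore S x i.1)))
      | none => none

/-- The denotational semantics: defined iff all approximations are, and then
the limit (least upper bound) of the ω-chain of approximations. -/
def sem (cs : List (Cmd Qubit Var)) (ψ : QState Qubit) (S : Store Var ℕ) :
    Option (BTree Qubit Var) :=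
  if h : ∀ n, (semN n cs ψ S).isSome then
    some (fun p =>
      if h1 : ∃ n l, ((semN n cs ψ S).get (h n)) p = some l ∧ l ≠ BLabel.nil then
        some h1.choose_spec.choose
      else if ∃ n, ((semN n cs ψ S).get (h n)) p = some BLabel.nil then some BLabel.nil
      else none)
  else none

/-! ## Operational semantics -/

/-- A configuration: a sequence of commands, a quantum state and a store. -/
abbrev Config (Qubit Var : Type) : Type :=
  List (Cmd Qubit Var) × QState Qubit × Store Var ℕ

/-- Small-step reduction; measurement steps are labelled by their outcome. -/
inductive Step : Config Qubit Var → Option ℕ → Config Qubit Var → Prop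
  | skip (cs ψ S) : Step (Cmd.skip :: cs, ψ, S) none (cs, ψ, S)
  | seq (c c' cs ψ S) : Step (Cmd.seq c c' :: cs, ψ, S) none (c :: c' :: cs, ψ, S)
  | iteTrue (e c1 c0 cs ψ S) : Expr.eval S e = some 1 →
      Step (Cmd.ite e c1 c0 :: cs, ψ, S) none (c1 :: cs, ψ, S)
  | iteFalse (e c1 c0 cs ψ S) : Expr.eval S e = some 0 →
      Step (Cmd.ite e c1 c0 :: cs, ψ, S) none (c0 :: cs, ψ, S)
  | whileStep (e c cs ψ S) :
      Step (Cmd.whileC e c :: cs, ψ, S) none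
        (Cmd.ite e (Cmd.seq c (Cmd.whileC e c)) Cmd.skip :: cs, ψ, S)
  | assign (x e cs ψ S v0 v) : S x = some v0 → Expr.eval S e = some v →
      Step (Cmd.assign x e :: cs, ψ, S) none (cs, ψ, updStore S x v)
  | unitary (nq) (U : UnitaryOp nq) (qs cs ψ ψ' S) : applyOp U.mat qs ψ = some ψ' →
      Step (Cmd.unitary nq U qs :: cs, ψ, S) none (cs, ψ', S)
  | measure (x k nq) (M : MeasOp k nq) (qs cs ψ ψ' S v0) (i : Fin k) :
      S x = some v0 → applyOp (M.ops i) qs ψ = some ψ' →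
      Step (Cmd.measure x k nq M qs :: cs, ψ, S) (some i.1) (cs, ψ', updStore S x i.1)

/-- Finitely many reduction steps, recording the list of measurement labels. -/
inductive Steps : Config Qubit Var → List ℕ → Config Qubit Var → Prop
  | refl (c) : Steps c [] c
  | step {c₁ lbl c₂ tr c₃} : Step c₁ lbl c₂ → Steps c₂ tr c₃ →
      Steps c₁ (lbl.toList ++ tr) c₃

theorem branchOpt_some {k : ℕ} {f : Fin k → Option (BTree Qubit Var)} {t : BTree Qubit Var}
    (h : branchOpt k f = some t) :
    ∃ g : Fin k → BTree Qubit Var, (∀ i, f i = some (g i)) ∧ t = branchTree k g := by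
  unfold branchOpt at h
  split_ifs at h with h1
  refine ⟨fun i => (f i).get (h1 i), fun i => by simp, ?_⟩
  exact (Option.some.inj h).symm

theorem applyOp_isSome {n : ℕ} (m m' : (Fin n → Bool) → (Fin n → Bool) → ℂ)
    (qs : Fin n → Qubit) (ψ ψ' : QState Qubit) (h : applyOp m qs ψ = some ψ') :
    ∃ ψ'', applyOp m' qs ψ = some ψ'' := by
  unfold applyOp at h ⊢
  split_ifs at h with h1
  rw [dif_pos h1]
  exact ⟨_, rfl⟩

theorem MeasOp.pos {k n : ℕ} (M : MeasOp k n) : 0 < k := by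
  rcases Nat.eq_zero_or_pos k with h | h
  · subst h
    have := M.complete (fun _ => true) (fun _ => true)
    simp at this
  · exact h

theorem step_sem {c c' : Config Qubit Var} {lbl : Option ℕ} (h : Step c lbl c') (n : ℕ)
    (t : BTree Qubit Var) (ht : semN (n + 1) c.1 c.2.1 c.2.2 = some t) :
    ∃ t', semN n c'.1 c'.2.1 c'.2.2 = some t' ∧ ∀ p, t (lbl.toList ++ p) = t' p := by
  cases h with
  | skip => exact ⟨t, by simpa [semN] using ht, fun _ => rfl⟩
  | seq => exact ⟨t, by simpa [semN] using ht, fun _ => rfl⟩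
  | iteTrue e c1 c0 cs ψ S h => exact ⟨t, by simpa [semN, h] using ht, fun _ => rfl⟩
  | iteFalse e c1 c0 cs ψ S h => exact ⟨t, by simpa [semN, h] using ht, fun _ => rfl⟩
  | whileStep => exact ⟨t, by simpa [semN] using ht, fun _ => rfl⟩
  | assign x e cs ψ S v0 v h1 h2 => exact ⟨t, by simpa [semN, h1, h2] using ht, fun _ => rfl⟩
  | unitary nq U qs cs ψ ψ' S h => exact ⟨t, by simpa [semN, h] using ht, fun _ => rfl⟩
  | measure x k nq M qs cs ψ ψ' S v0 i h1 h2 =>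
    simp only [semN, h1] at ht
    obtain ⟨g, hg, rfl⟩ := branchOpt_some ht
    refine ⟨g i, ?_, fun p => ?_⟩
    · simpa [h2] using hg i
    · simp [branchTree]

theorem steps_sem {c c' : Config Qubit Var} {tr : List ℕ} (h : Steps c tr c')
    (hs : ∀ n, (semN n c.1 c.2.1 c.2.2).isSome) :
    ∀ n, (semN n c'.1 c'.2.1 c'.2.2).isSome := by
  induction h with
  | refl => exact hs
  | step h1 _ ih =>
    apply ih
    intro n
    obtain ⟨t, ht⟩ := Option.isSome_iff_exists.1 (hs (n + 1))
    obtain ⟨t', ht', _⟩ := step_sem h1 n t ht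
    simp [ht']

theorem sem_step (c : Config Qubit Var) (hc : c.1 ≠ []) (n : ℕ)
    (h : (semN (n + 1) c.1 c.2.1 c.2.2).isSome) : ∃ lbl c', Step c lbl c' := by
  obtain ⟨cs, ψ, S⟩ := c
  cases cs with
  | nil => exact absurd rfl hc
  | cons c cs =>
    cases c with
    | skip => exact ⟨_, _, Step.skip ..⟩
    | seq => exact ⟨_, _, Step.seq ..⟩
    | whileC => exact ⟨_, _, Step.whileStep ..⟩
    | ite e c1 c0 =>
      simp only [semN] at h
      split at h
      · next h1 => exact ⟨_, _, Step.iteTrue _ _ _ _ _ _ h1⟩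
      · next h1 => exact ⟨_, _, Step.iteFalse _ _ _ _ _ _ h1⟩
      · simp at h
    | assign x e =>
      simp only [semN] at h
      split at h
      · next h1 h2 => exact ⟨_, _, Step.assign _ _ _ _ _ _ _ h1 h2⟩
      · simp at h
    | unitary nq U qs =>
      simp only [semN] at h
      split at h
      · next h1 => exact ⟨_, _, Step.unitary _ _ _ _ _ _ _ h1⟩
      · simp at h
    | measure x k nq M qs =>
      simp only [semN] at h
      split at h
      · next h1 =>
        obtain ⟨t, ht⟩ := Option.isSome_iff_exists.1 h
        obtain ⟨g, hg, rfl⟩ := branchOpt_some ht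
        obtain ⟨ψ', h2, _⟩ := Option.bind_eq_some_iff.1 (hg ⟨0, M.pos⟩)
        exact ⟨_, _, Step.measure _ _ _ _ _ _ _ _ _ _ _ h1 h2⟩
      · simp at h

theorem safe_sem (n : ℕ) : ∀ c : Config Qubit Var,
    (∀ c' : Config Qubit Var, (∃ tr, Steps c tr c') → c'.1 ≠ [] → ∃ lbl c'', Step c' lbl c'') →
    (semN n c.1 c.2.1 c.2.2).isSome := by
  induction n with
  | zero => intro c _; simp [semN]
  | succ n ih =>
    intro c hc
    have key : ∀ lbl c', Step c lbl c' → (semN n c'.1 c'.2.1 c'.2.2).isSome := by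
      intro lbl c' h
      apply ih
      rintro c'' ⟨tr, htr⟩
      exact hc c'' ⟨_, Steps.step h htr⟩
    obtain ⟨cs, ψ, S⟩ := c
    cases cs with
    | nil => simp [semN]
    | cons c cs =>
      obtain ⟨lbl, c', h⟩ := hc _ ⟨[], Steps.refl _⟩ (by simp)
      have k := key _ _ h
      cases h with
      | skip => simpa [semN] using k
      | seq => simpa [semN] using k
      | iteTrue e c1 c0 cs ψ S h => simpa [semN, h] using k
      | iteFalse e c1 c0 cs ψ S h => simpa [semN, h] using k
      | whileStep => simpa [semN] using k
      | assign x e cs ψ S v0 v h1 h2 => simpa [semN, h1, h2] using k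
      | unitary nq U qs cs ψ ψ' S h => simpa [semN, h] using k
      | measure x k' nq M qs cs ψ ψ' S v0 i h1 h2 =>
        simp only [semN, h1]
        unfold branchOpt
        rw [dif_pos]
        · rfl
        intro j
        obtain ⟨ψ'', h3⟩ := applyOp_isSome _ (M.ops j) _ _ _ h2
        simpa [h3] using key _ _ (Step.measure _ _ _ _ _ cs _ _ _ _ _ h1 h3)

theorem steps_leaf {c c' : Config Qubit Var} {tr : List ℕ} (h : Steps c tr c')
    (hc' : c'.1 = []) :
    ∃ N, ∀ n t, semN n c.1 c.2.1 c.2.2 = some t →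
      (∀ p, p ≠ [] → t (tr ++ p) = none) ∧
      (∀ l, t tr = some l → l ≠ BLabel.nil → l = BLabel.leaf c'.2) ∧
      (N ≤ n → t tr = some (BLabel.leaf c'.2)) := by
  induction h with
  | refl c =>
    obtain ⟨cs, ψ, S⟩ := c
    obtain rfl : cs = [] := hc'
    refine ⟨1, fun n t ht => ?_⟩
    cases n with
    | zero =>
      obtain rfl : nilTree = t := by simpa [semN] using ht
      refine ⟨fun p hp => by simp [nilTree, hp], fun l hl hn => ?_, fun h => by omega⟩
      simp [nilTree] at hl
      exact absurd hl.symm hn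
    | succ n =>
      obtain rfl : leafTree (ψ, S) = t := by simpa [semN] using ht
      refine ⟨fun p hp => by simp [leafTree, hp], fun l hl hn => ?_, fun h => ?_⟩
      · simp [leafTree] at hl
        exact hl.symm
      · simp [leafTree]
  | @step c₁ lbl c₂ tr c₃ h1 _ ih =>
    obtain ⟨N, hN⟩ := ih hc'
    refine ⟨N + 1, fun n t ht => ?_⟩
    cases n with
    | zero =>
      obtain rfl : nilTree = t := by simpa [semN] using ht
      refine ⟨fun p hp => by simp [nilTree, hp], fun l hl hn => ?_, fun h => by omega⟩
      simp [nilTree] at hl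
      exact absurd hl.2.symm hn
    | succ n =>
      obtain ⟨t', ht', hp⟩ := step_sem h1 n t ht
      obtain ⟨a, b, c⟩ := hN n t' ht'
      refine ⟨fun p hpp => ?_, fun l hl hn => ?_, fun h => ?_⟩
      · rw [List.append_assoc, hp]; exact a p hpp
      · rw [hp] at hl; exact b l hl hn
      · rw [hp]; exact c (by omega)

theorem leaf_steps (n : ℕ) : ∀ (cs : List (Cmd Qubit Var)) (ψ : QState Qubit)
    (S : Store Var ℕ) (t : BTree Qubit Var)
    (tr : List ℕ) (φ : QState Qubit) (S' : Store Var ℕ),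
    semN n cs ψ S = some t → t tr = some (BLabel.leaf (φ, S')) →
    Steps (cs, ψ, S) tr (([], φ, S') : Config Qubit Var) := by
  induction n with
  | zero =>
    intro cs ψ S t tr φ S' ht hl
    obtain rfl : nilTree = t := by simpa [semN] using ht
    simp [nilTree] at hl
  | succ n ih =>
    intro cs ψ S t tr φ S' ht hl
    cases cs with
    | nil =>
      obtain rfl : leafTree (ψ, S) = t := by simpa [semN] using ht
      unfold leafTree at hl
      split_ifs at hl with h
      cases hl
      subst h
      exact Steps.refl _
    | cons c cs =>
      cases c with
      | skip => exact Steps.step (Step.skip ..) (ih _ _ _ _ _ _ _ ht hl)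
      | seq => exact Steps.step (Step.seq ..) (ih _ _ _ _ _ _ _ ht hl)
      | whileC => exact Steps.step (Step.whileStep ..) (ih _ _ _ _ _ _ _ ht hl)
      | ite e c1 c0 =>
        simp only [semN] at ht
        split at ht
        · next h1 => exact Steps.step (Step.iteTrue _ _ _ _ _ _ h1) (ih _ _ _ _ _ _ _ ht hl)
        · next h1 => exact Steps.step (Step.iteFalse _ _ _ _ _ _ h1) (ih _ _ _ _ _ _ _ ht hl)
        · simp at ht
      | assign x e =>
        simp only [semN] at ht
        split at ht
        · next h1 h2 =>
          exact Steps.step (Step.assign _ _ _ _ _ _ _ h1 h2) (ih _ _ _ _ _ _ _ ht hl)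
        · simp at ht
      | unitary nq U qs =>
        simp only [semN] at ht
        split at ht
        · next h1 => exact Steps.step (Step.unitary _ _ _ _ _ _ _ h1) (ih _ _ _ _ _ _ _ ht hl)
        · simp at ht
      | measure x k nq M qs =>
        simp only [semN] at ht
        split at ht
        · next h1 =>
          obtain ⟨g, hg, rfl⟩ := branchOpt_some ht
          cases tr with
          | nil => simp [branchTree] at hl
          | cons i tr =>
            simp only [branchTree] at hl
            split_ifs at hl with hi
            obtain ⟨ψ', h2, h3⟩ := Option.bind_eq_some_iff.1 (hg ⟨i, hi⟩)
            exact Steps.step (Step.measure x k nq M qs cs ψ ψ' S _ ⟨i, hi⟩ h1 h2)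
              (ih _ _ _ _ _ _ _ h3 hl)
        · simp at ht

theorem sem_isSome (cs : List (Cmd Qubit Var)) (ψ : QState Qubit) (S : Store Var ℕ) :
    (sem cs ψ S).isSome ↔ ∀ n, (semN n cs ψ S).isSome := by
  unfold sem
  split_ifs with h
  · exact ⟨fun _ => h, fun _ => rfl⟩
  · exact ⟨fun h' => absurd h' (by simp), fun h' => absurd h' h⟩

theorem sem_label {cs : List (Cmd Qubit Var)} {ψ : QState Qubit} {S : Store Var ℕ}
    {t : BTree Qubit Var} (h : sem cs ψ S = some t) {p : List ℕ} {l : BLabel Qubit Var}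
    (hl : t p = some l) : ∃ n u, semN n cs ψ S = some u ∧ u p = some l := by
  unfold sem at h
  split_ifs at h with h0
  obtain rfl := Option.some.inj h
  dsimp only at hl
  split_ifs at hl with h1 h2
  · obtain rfl := Option.some.inj hl
    exact ⟨h1.choose, _, (Option.some_get _).symm, h1.choose_spec.choose_spec.1⟩
  · obtain rfl := Option.some.inj hl
    obtain ⟨n, hn⟩ := h2
    exact ⟨n, _, (Option.some_get _).symm, hn⟩

theorem sem_leaf {cs : List (Cmd Qubit Var)} {ψ : QState Qubit} {S : Store Var ℕ}
    {t : BTree Qubit Var} (h : sem cs ψ S = some t) {p : List ℕ} {n : ℕ} {u : BTree Qubit Var}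
    {l : BLabel Qubit Var} (hu : semN n cs ψ S = some u) (hl : u p = some l)
    (hn : l ≠ BLabel.nil) : ∃ l', t p = some l' ∧ l' ≠ BLabel.nil := by
  unfold sem at h
  split_ifs at h with h0
  obtain rfl := Option.some.inj h
  dsimp only
  have h1 : ∃ n l, ((semN n cs ψ S).get (h0 n)) p = some l ∧ l ≠ BLabel.nil :=
    ⟨n, l, by
      have e : (semN n cs ψ S).get (h0 n) = u :=
        Option.some.inj ((Option.some_get (h0 n)).trans hu)
      rw [e]; exact hl, hn⟩
  rw [dif_pos h1]
  exact ⟨_, rfl, h1.choose_spec.choose_spec.2⟩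

/-- Equivalence of the operational and denotational semantics. -/
theorem opsem_denosem_equiv {Qubit Var : Type} (cs : List (Cmd Qubit Var))
    (ψ : QState Qubit) (S : Store Var ℕ) :
    ((∀ c' : Config Qubit Var,
        (∃ tr, Steps (cs, ψ, S) tr c') → c'.1 ≠ [] → ∃ lbl c'', Step c' lbl c'')
      ↔ (sem cs ψ S).isSome)
    ∧ (∀ t, sem cs ψ S = some t →
        ∀ (is : List ℕ) (φ : QState Qubit) (S' : Store Var ℕ),
          Steps (cs, ψ, S) is (([], φ, S') : Config Qubit Var)
            ↔ t.access is = leafTree (φ, S')) := by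
  refine ⟨⟨fun h => (sem_isSome _ _ _).2 fun n => safe_sem n _ h, ?_⟩, ?_⟩
  · rintro h c' ⟨tr, htr⟩ hc'
    exact sem_step c' hc' 0 (steps_sem htr ((sem_isSome _ _ _).1 h) 1)
  · intro t ht is φ S'
    constructor
    · intro hs
      obtain ⟨N, hN⟩ := steps_leaf hs rfl
      have hall := (sem_isSome cs ψ S).1 (by simp [ht])
      funext p
      by_cases hp : p = []
      · subst hp
        obtain ⟨u, hu⟩ := Option.isSome_iff_exists.1 (hall N)
        obtain ⟨l, hl, hn⟩ := sem_leaf ht hu ((hN N u hu).2.2 le_rfl) (by simp)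
        obtain ⟨n, v, hv, hvl⟩ := sem_label ht hl
        have := (hN n v hv).2.1 l hvl hn
        simp [BTree.access, leafTree, hl, this]
      · simp only [BTree.access, leafTree, if_neg hp]
        by_contra hne
        obtain ⟨l, hl⟩ := Option.ne_none_iff_exists'.1 hne
        obtain ⟨n, v, hv, hvl⟩ := sem_label ht hl
        have := (hN n v hv).1 p hp
        rw [this] at hvl
        cases hvl
    · intro h
      have h1 : t is = some (BLabel.leaf (φ, S')) := by
        have := congrFun h []
        simpa [BTree.access, leafTree] using this
      obtain ⟨n, v, hv, hvl⟩ := sem_label ht h1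
      exact leaf_steps n _ _ _ _ _ _ _ hv hvl
end QSL
end
end

section
/- Algebraic characterization of incompatibility: for all resources x and y, the following three conditions are equivalent: (1) x ♯ y; (2) for all resources k and h, the expression k·x + h·y is undefined (there exist no k, h for which the two products and their sum are all defined); (3) for every resource z, either k·x + z is undefined for every resource k, or h·y + z is undefined for every resource h. -/
open scoped Classical

noncomputable section

namespace QSL

variable {Qubit Var Val : Type}

theorem rmul_ext {k x u : Res Qubit Var Val} (h : rmul k x = some u) (v : Var) (a : Val)
    (ha : x.2 v = some a) : u.2 v = some a := by
  unfold rmul at h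
  split_ifs at h with hc
  have h' := Option.some.inj h
  subst h'
  have := hc.2 v
  rw [ha] at this
  have hk : k.2 v = none := by simpa using this
  simp [hk, ha]

theorem radd_eq_none {u z : Res Qubit Var Val} :
    radd u z = none ↔ ¬ (u.1.1 = z.1.1 ∧ u.2 = z.2) := by
  unfold radd
  split_ifs with hc <;> simp [hc]

theorem compat_ex (x y : Res Qubit Var Val) (hn : ¬ incompat x y) :
    ∃ k h u v : Res Qubit Var Val, rmul k x = some u ∧ rmul h y = some v ∧
      u.1.1 = v.1.1 ∧ u.2 = v.2 := by
  have key : ∀ a b : Res Qubit Var Val, ∃ k u : Res Qubit Var Val, rmul k a = some u ∧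
      u.1.1 = a.1.1 ∪ b.1.1 ∧ u.2 = fun v => a.2 v <|> b.2 v := by
    intro a b
    let k : Res Qubit Var Val :=
      (⟨b.1.1 \ a.1.1, fun _ => 0⟩, fun v => if a.2 v = none then b.2 v else none)
    have hc : Disjoint k.1.1 a.1.1 ∧ ∀ v, k.2 v = none ∨ a.2 v = none := by
      refine ⟨Finset.sdiff_disjoint, fun v => ?_⟩
      by_cases hv : a.2 v = none
      · exact Or.inr hv
      · exact Or.inl (if_neg hv)
    refine ⟨k, _, dif_pos hc, ?_, ?_⟩
    · show b.1.1 \ a.1.1 ∪ a.1.1 = a.1.1 ∪ b.1.1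
      ext q
      simp only [Finset.mem_union, Finset.mem_sdiff]
      tauto
    · funext v
      show ((if a.2 v = none then b.2 v else none) <|> a.2 v) = (a.2 v <|> b.2 v)
      cases h1 : a.2 v <;> cases h2 : b.2 v <;> simp
  obtain ⟨k, u, h1, h2, h3⟩ := key x y
  obtain ⟨h, v, g1, g2, g3⟩ := key y x
  refine ⟨k, h, u, v, h1, g1, ?_, ?_⟩
  · rw [h2, g2, Finset.union_comm]
  · rw [h3, g3]
    funext w
    cases e1 : x.2 w with
    | none => cases e2 : y.2 w <;> simp
    | some a =>
      cases e2 : y.2 w with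
      | none => simp
      | some b =>
        have : a = b := by
          by_contra hab
          exact hn ⟨w, a, b, e1, e2, hab⟩
        simp [this]

/-- Algebraic characterization of incompatibility: the three conditions are
equivalent. -/
theorem incompat_characterization {Qubit Var Val : Type} (x y : Res Qubit Var Val) :
    (incompat x y ↔
      ∀ k h : Res Qubit Var Val,
        (rmul k x).bind (fun u => (rmul h y).bind (fun v => radd u v)) = none)
    ∧ (incompat x y ↔
      ∀ z : Res Qubit Var Val,
        (∀ k : Res Qubit Var Val, (rmul k x).bind (fun u => radd u z) = none) ∨
        (∀ h : Res Qubit Var Val, (rmul h y).bind (fun v => radd v z) = none)) := by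
  refine ⟨⟨?_, ?_⟩, ⟨?_, ?_⟩⟩
  · rintro ⟨w, a, b, hx, hy, hab⟩ k h
    cases e1 : rmul k x with
    | none => rfl
    | some u =>
      cases e2 : rmul h y with
      | none => rfl
      | some v =>
        refine radd_eq_none.2 fun hc => hab ?_
        have p := rmul_ext e1 w a hx
        have q := rmul_ext e2 w b hy
        rw [hc.2, q] at p
        exact (Option.some.inj p).symm
  · intro H
    by_contra hn
    obtain ⟨k, h, u, v, h1, h2, h3, h4⟩ := compat_ex x y hn
    have := H k h
    rw [h1, h2] at this
    exact radd_eq_none.1 this ⟨h3, h4⟩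
  · rintro ⟨w, a, b, hx, hy, hab⟩ z
    by_contra! hz
    obtain ⟨⟨k, hk⟩, ⟨h, hh⟩⟩ := hz
    cases e1 : rmul k x with
    | none => rw [e1] at hk; exact hk rfl
    | some u =>
      cases e2 : rmul h y with
      | none => rw [e2] at hh; exact hh rfl
      | some v =>
        rw [e1] at hk
        rw [e2] at hh
        have hk' := not_not.1 (fun c => hk (radd_eq_none.2 c))
        have hh' := not_not.1 (fun c => hh (radd_eq_none.2 c))
        have p := rmul_ext e1 w a hx
        have q := rmul_ext e2 w b hy
        rw [hk'.2, ← hh'.2, q] at p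
        exact hab (Option.some.inj p).symm
  · intro H
    by_contra hn
    obtain ⟨k, h, u, v, h1, h2, h3, h4⟩ := compat_ex x y hn
    rcases H v with H | H
    · have := H k
      rw [h1] at this
      exact radd_eq_none.1 this ⟨h3, h4⟩
    · have := H h
      rw [h2] at this
      exact radd_eq_none.1 this ⟨rfl, rfl⟩
end QSL
end
end

section
/- The resources form a resource ring: the partial product has the unit element as a two-sided unit, and is commutative and associative; the partial sum is commutative and associative; and distributivity (a + b)·c = a·c + b·c holds; here all equations are Kleene equalities (the left-hand side is defined if and only if the right-hand side is defined, and in that case the two sides are equal). -/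
open scoped Classical

noncomputable section

namespace QSL

variable {Qubit Var Val : Type}

theorem res_ext {a b : Res Qubit Var Val} (h : a.1.1 = b.1.1)
    (hv : ∀ f : Qubit → Bool, a.1.2 (fun q => f q.1) = b.1.2 (fun q => f q.1))
    (hs : ∀ x, a.2 x = b.2 x) : a = b := by
  obtain ⟨⟨Q, v⟩, s⟩ := a
  obtain ⟨⟨Q', w⟩, t⟩ := b
  dsimp only at h hv hs
  subst h
  have h1 : v = w := by
    funext f
    have := hv (fun q => if hq : q ∈ Q then f ⟨q, hq⟩ else false)
    simpa using this
  have h2 : s = t := funext hs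
  subst h1 h2
  rfl

theorem castVec_apply {Q Q' : Finset Qubit} (h : Q = Q') (v : Vec Q) (f : Qubit → Bool) :
    castVec h v (fun q => f q.1) = v (fun q => f q.1) := by
  subst h
  rfl

def mulOk (a b : Res Qubit Var Val) : Prop :=
  Disjoint a.1.1 b.1.1 ∧ ∀ x, a.2 x = none ∨ b.2 x = none

def mulV (a b : Res Qubit Var Val) : Res Qubit Var Val :=
  (⟨a.1.1 ∪ b.1.1, tensorVec a.1.2 b.1.2⟩, fun x => a.2 x <|> b.2 x)

theorem rmul_pos {a b : Res Qubit Var Val} (h : mulOk a b) : rmul a b = some (mulV a b) :=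
  dif_pos h

theorem rmul_neg {a b : Res Qubit Var Val} (h : ¬ mulOk a b) : rmul a b = none :=
  dif_neg h

theorem mulV_store (a b : Res Qubit Var Val) (x : Var) :
    (mulV a b).2 x = (a.2 x).or (b.2 x) := by
  change (a.2 x <|> b.2 x) = _
  cases a.2 x <;> rfl

theorem mulV_vec (a b : Res Qubit Var Val) (f : Qubit → Bool) :
    (mulV a b).1.2 (fun q => f q.1) = a.1.2 (fun q => f q.1) * b.1.2 (fun q => f q.1) := rfl

theorem mulV_q (a b : Res Qubit Var Val) : (mulV a b).1.1 = a.1.1 ∪ b.1.1 := rfl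

def addOk (a b : Res Qubit Var Val) : Prop := a.1.1 = b.1.1 ∧ a.2 = b.2

def addV (a b : Res Qubit Var Val) (h : addOk a b) : Res Qubit Var Val :=
  (⟨b.1.1, fun f => castVec h.1 a.1.2 f + b.1.2 f⟩, b.2)

theorem radd_pos {a b : Res Qubit Var Val} (h : addOk a b) : radd a b = some (addV a b h) :=
  dif_pos h

theorem radd_neg {a b : Res Qubit Var Val} (h : ¬ addOk a b) : radd a b = none :=
  dif_neg h

theorem addV_vec (a b : Res Qubit Var Val) (h : addOk a b) (f : Qubit → Bool) :
    (addV a b h).1.2 (fun q => f q.1) = a.1.2 (fun q => f q.1) + b.1.2 (fun q => f q.1) := by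
  change castVec h.1 a.1.2 (fun q => f q.1) + _ = _
  rw [castVec_apply]
  rfl

theorem mulOk_comm {a b : Res Qubit Var Val} : mulOk a b ↔ mulOk b a := by
  unfold mulOk
  rw [disjoint_comm]
  simp only [or_comm]

theorem rmul_comm' (a b : Res Qubit Var Val) : rmul a b = rmul b a := by
  by_cases h : mulOk a b
  · rw [rmul_pos h, rmul_pos (mulOk_comm.1 h)]
    congr 1
    refine res_ext (Finset.union_comm _ _) (fun f => ?_) (fun x => ?_)
    · rw [mulV_vec, mulV_vec, mul_comm]
    · rw [mulV_store, mulV_store]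
      rcases h.2 x with h | h <;> simp [h]
  · rw [rmul_neg h, rmul_neg (fun h' => h (mulOk_comm.1 h'))]

theorem unit_rmul (a : Res Qubit Var Val) : rmul unitRes a = some a := by
  have h : mulOk unitRes a := ⟨Finset.disjoint_empty_left _, fun x => Or.inl rfl⟩
  rw [rmul_pos h]
  congr 1
  refine res_ext (Finset.empty_union _) (fun f => ?_) (fun x => ?_)
  · rw [mulV_vec]
    exact one_mul _
  · rw [mulV_store]
    rfl

theorem mulOk_assoc (a b c : Res Qubit Var Val) :
    (mulOk a b ∧ mulOk (mulV a b) c) ↔ (mulOk b c ∧ mulOk a (mulV b c)) := by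
  simp only [mulOk, mulV_q, mulV_store, Finset.disjoint_union_left, Finset.disjoint_union_right,
    Option.or_eq_none_iff]
  constructor
  · rintro ⟨⟨h1, h2⟩, ⟨h3, h4⟩, h5⟩
    exact ⟨⟨h4, fun x => by have := h2 x; have := h5 x; tauto⟩, ⟨h1, h3⟩,
      fun x => by have := h2 x; have := h5 x; tauto⟩
  · rintro ⟨⟨h1, h2⟩, ⟨h3, h4⟩, h5⟩
    exact ⟨⟨h3, fun x => by have := h2 x; have := h5 x; tauto⟩, ⟨h4, h1⟩,
      fun x => by have := h2 x; have := h5 x; tauto⟩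

theorem bind_left (a b c : Res Qubit Var Val) :
    (rmul a b).bind (fun x => rmul x c) =
      if mulOk a b ∧ mulOk (mulV a b) c then some (mulV (mulV a b) c) else none := by
  by_cases h : mulOk a b
  · by_cases h' : mulOk (mulV a b) c
    · simp [rmul_pos h, rmul_pos h', h, h']
    · simp [rmul_pos h, rmul_neg h', h']
  · simp [rmul_neg h, h]

theorem bind_right (a b c : Res Qubit Var Val) :
    (rmul b c).bind (fun x => rmul a x) =
      if mulOk b c ∧ mulOk a (mulV b c) then some (mulV a (mulV b c)) else none := by
  by_cases h : mulOk b c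
  · by_cases h' : mulOk a (mulV b c)
    · simp [rmul_pos h, rmul_pos h', h, h']
    · simp [rmul_pos h, rmul_neg h', h']
  · simp [rmul_neg h, h]

theorem rmul_assoc' (a b c : Res Qubit Var Val) :
    (rmul a b).bind (fun x => rmul x c) = (rmul b c).bind (fun x => rmul a x) := by
  rw [bind_left, bind_right]
  simp only [mulOk_assoc]
  congr 2
  refine res_ext (Finset.union_assoc _ _ _) (fun f => ?_) (fun x => ?_)
  · simp only [mulV_vec, mul_assoc]
  · simp only [mulV_store, Option.or_assoc]

theorem radd_comm' (a b : Res Qubit Var Val) : radd a b = radd b a := by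
  by_cases h : addOk a b
  · have h' : addOk b a := ⟨h.1.symm, h.2.symm⟩
    rw [radd_pos h, radd_pos h']
    congr 1
    refine res_ext h.1.symm (fun f => ?_) (fun x => congrFun h.2.symm x)
    rw [addV_vec, addV_vec, add_comm]
  · rw [radd_neg h, radd_neg (fun h' => h ⟨h'.1.symm, h'.2.symm⟩)]

theorem radd_assoc' (a b c : Res Qubit Var Val) :
    (radd a b).bind (fun x => radd x c) = (radd b c).bind (fun x => radd a x) := by
  by_cases h : addOk a b
  · by_cases k : addOk b c
    · have h1 : addOk (addV a b h) c := k
      have h2 : addOk a (addV b c k) := ⟨h.1.trans k.1, h.2.trans k.2⟩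
      rw [radd_pos h, radd_pos k, Option.bind_some, Option.bind_some, radd_pos h1, radd_pos h2]
      congr 1
      refine res_ext rfl (fun f => ?_) (fun x => rfl)
      simp only [addV_vec, add_assoc]
    · have h1 : ¬ addOk (addV a b h) c := k
      rw [radd_pos h, radd_neg k, Option.bind_some, radd_neg h1]
      rfl
  · by_cases k : addOk b c
    · have h2 : ¬ addOk a (addV b c k) :=
        fun h' => h ⟨h'.1.trans k.1.symm, h'.2.trans k.2.symm⟩
      rw [radd_neg h, radd_pos k, Option.bind_some, radd_neg h2]
      rfl
    · rw [radd_neg h, radd_neg k]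
      rfl

theorem addOk_of_mul {a b c : Res Qubit Var Val} (ha : mulOk a c) (hb : mulOk b c)
    (h : addOk (mulV a c) (mulV b c)) : addOk a b := by
  refine ⟨?_, ?_⟩
  · have h1 : a.1.1 ∪ c.1.1 = b.1.1 ∪ c.1.1 := h.1
    rw [← Finset.union_sdiff_cancel_right ha.1, h1, Finset.union_sdiff_cancel_right hb.1]
  · funext x
    have h1 := congrFun h.2 x
    rw [mulV_store, mulV_store] at h1
    rcases ha.2 x with h2 | h2 <;> rcases hb.2 x with h3 | h3 <;> simp_all

theorem distrib' (a b c : Res Qubit Var Val) :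
    (radd a b).bind (fun x => rmul x c) =
      (rmul a c).bind (fun u => (rmul b c).bind (fun v => radd u v)) := by
  by_cases h : addOk a b
  · by_cases k : mulOk b c
    · have h1 : mulOk (addV a b h) c := k
      have h2 : mulOk a c := by
        unfold mulOk
        rw [h.1, h.2]
        exact k
      have h3 : addOk (mulV a c) (mulV b c) := by
        refine ⟨?_, ?_⟩
        · rw [mulV_q, mulV_q, h.1]
        · funext x
          rw [mulV_store, mulV_store, h.2]
      rw [radd_pos h, rmul_pos k, rmul_pos h2, Option.bind_some, Option.bind_some,
        Option.bind_some, rmul_pos h1, radd_pos h3]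
      congr 1
      refine res_ext rfl (fun f => ?_) (fun x => rfl)
      simp only [addV_vec, mulV_vec, add_mul]
    · have h1 : ¬ mulOk (addV a b h) c := k
      rw [radd_pos h, rmul_neg k, Option.bind_some, rmul_neg h1]
      simp
  · rw [radd_neg h]
    by_cases ha : mulOk a c
    · by_cases hb : mulOk b c
      · rw [rmul_pos ha, rmul_pos hb, Option.bind_some, Option.bind_some,
          radd_neg (fun h' => h (addOk_of_mul ha hb h'))]
        rfl
      · rw [rmul_neg hb]
        simp
    · rw [rmul_neg ha]
      rfl

/-- The resources form a resource ring (all equations are Kleene equalities,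
`none` playing the role of "undefined"). -/
theorem resource_ring {Qubit Var Val : Type} :
    (∀ a : Res Qubit Var Val, rmul unitRes a = some a) ∧
    (∀ a : Res Qubit Var Val, rmul a unitRes = some a) ∧
    (∀ a b : Res Qubit Var Val, rmul a b = rmul b a) ∧
    (∀ a b c : Res Qubit Var Val,
      (rmul a b).bind (fun x => rmul x c) = (rmul b c).bind (fun x => rmul a x)) ∧
    (∀ a b : Res Qubit Var Val, radd a b = radd b a) ∧
    (∀ a b c : Res Qubit Var Val,
      (radd a b).bind (fun x => radd x c) = (radd b c).bind (fun x => radd a x)) ∧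
    (∀ a b c : Res Qubit Var Val,
      (radd a b).bind (fun x => rmul x c) =
        (rmul a c).bind (fun u => (rmul b c).bind (fun v => radd u v))) := by
  exact ⟨unit_rmul, fun a => (rmul_comm' _ _).trans (unit_rmul a), rmul_comm', rmul_assoc',
    radd_comm', radd_assoc', distrib'⟩
end QSL
end
end

section
/- Soundness of the sum rule for Hoare triples: for any command C and SL propositions P, P', Q, Q', if {P} C {Q} and {P'} C {Q'} hold, then {P + P'} C {Q + Q'} holds. -/
open scoped Classical

noncomputable section

namespace QSL

variable {Qubit Var Val : Type}

/-! ## Multisets (possibly infinite, as families up to bijective reindexing) -/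

/-- An indexed family representing a multiset. -/
structure PreMSet (A : Type) : Type 1 where
  idx : Type
  val : idx → A

/-- Equivalence of indexed families by bijective reindexing. -/
def msetEquiv {A : Type} (f g : PreMSet A) : Prop :=
  ∃ e : f.idx ≃ g.idx, ∀ i, f.val i = g.val (e i)

theorem msetEquiv_refl {A : Type} (f : PreMSet A) : msetEquiv f f :=
  ⟨Equiv.refl _, fun _ => rfl⟩

theorem msetEquiv_symm {A : Type} {f g : PreMSet A} : msetEquiv f g → msetEquiv g f
  | ⟨e, h⟩ => ⟨e.symm, fun i => by rw [h (e.symm i), Equiv.apply_symm_apply]⟩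

theorem msetEquiv_trans {A : Type} {f g k : PreMSet A} :
    msetEquiv f g → msetEquiv g k → msetEquiv f k
  | ⟨e, h⟩, ⟨e', h'⟩ => ⟨e.trans e', fun i => (h i).trans (h' (e i))⟩

instance msetSetoid (A : Type) : Setoid (PreMSet A) :=
  ⟨msetEquiv, ⟨msetEquiv_refl, msetEquiv_symm, msetEquiv_trans⟩⟩

/-- Multisets over `A`: families up to bijective reindexing. -/
def MSet (A : Type) : Type 1 := Quotient (msetSetoid A)

def MSet.mk {A : Type} (I : Type) (f : I → A) : MSet A :=
  Quotient.mk (msetSetoid A) ⟨I, f⟩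

/-- A canonical representative family of a multiset. -/
def MSet.out {A : Type} (m : MSet A) : PreMSet A := Quotient.out m

/-- `a` is an occurrence of the multiset `m`. -/
def MSet.MemM {A : Type} (a : A) (m : MSet A) : Prop := ∃ i, m.out.val i = a

def MSet.map {A B : Type} (f : A → B) (m : MSet A) : MSet B :=
  MSet.mk m.out.idx (fun i => f (m.out.val i))

/-- Sum (disjoint union) of two multisets. -/
def MSet.uplus {A : Type} (m m' : MSet A) : MSet A :=
  MSet.mk (m.out.idx ⊕ m'.out.idx) (Sum.elim m.out.val m'.out.val)

/-- Indexed sum (disjoint union) of a family of multisets. -/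
def MSet.biguplus {A : Type} (I : Type) (f : I → MSet A) : MSet A :=
  MSet.mk (Σ x : I, (f x).out.idx) (fun p => (f p.1).out.val p.2)


/-- Partial product of multisets of resources: an occurrence `a·b` for every
pair of occurrences, defined iff all these resource products are defined. -/
def mprodM (m m' : MSet (Res Qubit Var Val)) : Option (MSet (Res Qubit Var Val)) :=
  if h : ∀ (i : m.out.idx) (j : m'.out.idx), (rmul (m.out.val i) (m'.out.val j)).isSome then
    some (MSet.mk (m.out.idx × m'.out.idx)
      (fun p => (rmul (m.out.val p.1) (m'.out.val p.2)).get (h p.1 p.2)))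
  else none

/-- Sum of the two projections of a multiset of pairs of resources (the
multiset of pairs plays the role of a multiset bijection between its two
projections): defined iff all the componentwise resource sums are defined. -/
def msumr (r : MSet (Res Qubit Var Val × Res Qubit Var Val)) :
    Option (MSet (Res Qubit Var Val)) :=
  if h : ∀ i, (radd (r.out.val i).1 (r.out.val i).2).isSome then
    some (MSet.mk r.out.idx (fun i => (radd (r.out.val i).1 (r.out.val i).2).get (h i)))
  else none

/-! ## SL propositions -/

/-- An SL proposition: a set of multisets of resources. -/
abbrev SLProp (Qubit Var Val : Type) : Type 1 := Set (MSet (Res Qubit Var Val))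


/-- Entailment of SL propositions: set inclusion. -/
def entails (P Q : SLProp Qubit Var Val) : Prop := P ⊆ Q

/-- Separating conjunction. -/
def star (P Q : SLProp Qubit Var Val) : SLProp Qubit Var Val :=
  { m | ∃ mp ∈ P, ∃ mq ∈ Q, mprodM mp mq = some m }

/-- Sum of SL propositions: all defined sums `m +_r m'` over `m ∈ P`, `m' ∈ Q`
and multiset bijections `r` between `m` and `m'`. -/
def propSum (P Q : SLProp Qubit Var Val) : SLProp Qubit Var Val :=
  { m | ∃ r : MSet (Res Qubit Var Val × Res Qubit Var Val),
      MSet.map Prod.fst r ∈ P ∧ MSet.map Prod.snd r ∈ Q ∧ msumr r = some m }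

/-- Indexed bare mixing. -/
def bigMix (I : Type) (P : I → SLProp Qubit Var Val) : SLProp Qubit Var Val :=
  { m | ∃ f : I → MSet (Res Qubit Var Val), (∀ x, f x ∈ P x) ∧ m = MSet.biguplus I f }

/-- Binary bare mixing, the case of `bigMix` over a two-element index set. -/
def binMix (P Q : SLProp Qubit Var Val) : SLProp Qubit Var Val :=
  bigMix Bool (fun b => if b then Q else P)

/-- Precision: any two multisets in `P` are equal. -/
def precise (P : SLProp Qubit Var Val) : Prop := ∀ m ∈ P, ∀ m' ∈ P, m = m'

/-- Non-emptiness of behaviours: every multiset in `P` is nonempty. -/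
def nonnb (P : SLProp Qubit Var Val) : Prop := ∀ m ∈ P, Nonempty (MSet.out m).idx

/-- Unambiguity: any two occurrences at distinct indices are incompatible. -/
def unambig (P : SLProp Qubit Var Val) : Prop :=
  ∀ m ∈ P, ∀ i j : (MSet.out m).idx, i ≠ j → incompat (m.out.val i) (m.out.val j)

/-- Incompatibility of SL propositions: every occurrence of every `m ∈ P` is
incompatible with every occurrence of every `m' ∈ Q`. -/
def propIncompat (P Q : SLProp Qubit Var Val) : Prop :=
  ∀ m ∈ P, ∀ m' ∈ Q, ∀ (i : (MSet.out m).idx) (j : (MSet.out m').idx),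
    incompat (m.out.val i) (m'.out.val j)

/-- The singleton proposition of the one-element multiset of a resource. -/
def singletonProp (a : Res Qubit Var Val) : SLProp Qubit Var Val :=
  { m | m = MSet.mk PUnit (fun _ => a) }

/-- The points-to proposition `ι ↦ v`: empty quantum state (scalar 1) and the
store mapping only `ι` to `v`. -/
def varPoints (ι : Var) (v : Val) : SLProp Qubit Var Val :=
  singletonProp (unitQ, fun y => if y = ι then some v else none)

/-- Tagged mixing over an index set of values. -/
def taggedMix (ι : Var) (I : Set Val) (P : Val → SLProp Qubit Var Val) :
    SLProp Qubit Var Val :=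
  bigMix I (fun x => star (varPoints ι x.1) (P x.1))

/-! ## Logical semantics and Hoare triples -/

/-- The multiset of leaves of a behaviour tree, indexed by the branch paths. -/
def Leaves (t : BTree Qubit Var) : MSet (Res Qubit Var ℕ) :=
  MSet.mk { p : List ℕ // ∃ a, t p = some (BLabel.leaf a) } (fun p => p.2.choose)

/-- Logical semantics of a command on a multiset of resources. -/
def msem (C : Cmd Qubit Var) (m : MSet (Res Qubit Var ℕ)) :
    Option (MSet (Res Qubit Var ℕ)) :=
  if h : ∀ i, (sem [C] (m.out.val i).1 (m.out.val i).2).isSome then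
    some (MSet.biguplus m.out.idx
      (fun i => Leaves ((sem [C] (m.out.val i).1 (m.out.val i).2).get (h i))))
  else none

/-- The Hoare triple `{P} C {Q}`. -/
def hoare (P : SLProp Qubit Var ℕ) (C : Cmd Qubit Var) (Q : SLProp Qubit Var ℕ) : Prop :=
  ∀ m ∈ P, ∃ m', msem C m = some m' ∧ m' ∈ Q

/-- Logical semantics of a pure expression: extend the store of every outcome
with the binding of the distinguished variable `ret` to the value of `e`. -/
def esem (ret : Var) (e : Expr Var) (m : MSet (Res Qubit Var ℕ)) :
    Option (MSet (Res Qubit Var ℕ)) :=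
  if h : ∀ i, (Expr.eval (m.out.val i).2 e).isSome then
    some (MSet.mk m.out.idx (fun i =>
      ((m.out.val i).1,
        updStore (m.out.val i).2 ret ((Expr.eval (m.out.val i).2 e).get (h i)))))
  else none

/-- The Hoare triple `{P} e {Q}` for a pure expression. -/
def ehoare (ret : Var) (P : SLProp Qubit Var ℕ) (e : Expr Var)
    (Q : SLProp Qubit Var ℕ) : Prop :=
  ∀ m ∈ P, ∃ m', esem ret e m = some m' ∧ m' ∈ Q

/-- The return token `rtok v`. -/
def rtok (ret : Var) (v : ℕ) : SLProp Qubit Var ℕ := varPoints ret v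

/-! ## Proof -/

inductive O3 {A : Type} (R : A → A → A → Prop) : Option A → Option A → Option A → Prop
  | none : O3 R none none none
  | some (a b c : A) (h : R a b c) : O3 R (some a) (some b) (some c)

inductive LR {Qubit Var : Type} : BLabel Qubit Var → BLabel Qubit Var → BLabel Qubit Var → Prop
  | branch (k : ℕ) : LR (.branch k) (.branch k) (.branch k)
  | leaf (a b c : Res Qubit Var ℕ) (h : radd a b = some c) : LR (.leaf a) (.leaf b) (.leaf c)
  | nil : LR .nil .nil .nil

def TR {Qubit Var : Type} (t1 t2 t3 : BTree Qubit Var) : Prop :=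
  ∀ p, O3 LR (t1 p) (t2 p) (t3 p)

def vadd {Qubit : Type} {Q : Finset Qubit} (v w : Vec Q) : Vec Q := fun f => v f + w f

theorem radd_same {Qubit Var Val : Type} {Q : Finset Qubit} (v w : Vec Q) (S : Store Var Val) :
    radd ((⟨Q, v⟩, S) : Res Qubit Var Val) (⟨Q, w⟩, S) = some (⟨Q, vadd v w⟩, S) := by
  unfold radd
  rw [dif_pos ⟨rfl, rfl⟩]
  rfl

theorem radd_inv {Qubit Var Val : Type} {a b c : Res Qubit Var Val} (h : radd a b = some c) :
    ∃ (Q : Finset Qubit) (v w : Vec Q) (S : Store Var Val),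
      a = (⟨Q, v⟩, S) ∧ b = (⟨Q, w⟩, S) ∧ c = (⟨Q, vadd v w⟩, S) := by
  obtain ⟨⟨Q, v⟩, S⟩ := a
  obtain ⟨⟨Q', w⟩, S'⟩ := b
  have hh : Q = Q' ∧ S = S' := by
    by_contra hn
    unfold radd at h
    rw [dif_neg hn] at h
    cases h
  obtain ⟨rfl, rfl⟩ := hh
  rw [radd_same] at h
  exact ⟨Q, v, w, S, rfl, rfl, (Option.some.inj h).symm⟩

theorem applyOp_add {Qubit : Type} {n : ℕ} (mat : (Fin n → Bool) → (Fin n → Bool) → ℂ)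
    (qs : Fin n → Qubit) {Q : Finset Qubit} (v w : Vec Q) :
    (applyOp mat qs ⟨Q, v⟩ = none ∧ applyOp mat qs ⟨Q, w⟩ = none ∧
      applyOp mat qs ⟨Q, vadd v w⟩ = none) ∨
    ∃ v' w' : Vec Q, applyOp mat qs ⟨Q, v⟩ = some ⟨Q, v'⟩ ∧ applyOp mat qs ⟨Q, w⟩ = some ⟨Q, w'⟩ ∧
      applyOp mat qs ⟨Q, vadd v w⟩ = some ⟨Q, vadd v' w'⟩ := by
  by_cases h : Function.Injective qs ∧ ∀ i, qs i ∈ Q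
  · right
    refine ⟨_, _, dif_pos h, dif_pos h, (dif_pos h).trans ?_⟩
    congr 2
    funext g
    simp only [vadd, mul_add, Finset.sum_add_distrib]
  · left
    exact ⟨dif_neg h, dif_neg h, dif_neg h⟩

theorem branchOpt_rel {Qubit Var : Type} (k : ℕ) (f1 f2 f3 : Fin k → Option (BTree Qubit Var))
    (h : ∀ i, O3 TR (f1 i) (f2 i) (f3 i)) :
    O3 TR (branchOpt k f1) (branchOpt k f2) (branchOpt k f3) := by
  by_cases hs : ∀ i, (f1 i).isSome
  · have key : ∀ i, ∃ a b c, f1 i = some a ∧ f2 i = some b ∧ f3 i = some c ∧ TR a b c := by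
      intro i
      have h1 := h i
      have h2 := hs i
      revert h1 h2
      generalize f1 i = x
      generalize f2 i = y
      generalize f3 i = z
      intro h1 h2
      cases h1 with
      | none => simp at h2
      | some a b c h => exact ⟨a, b, c, rfl, rfl, rfl, h⟩
    choose a b c ha hb hc hr using key
    obtain rfl : f1 = fun i => some (a i) := funext ha
    obtain rfl : f2 = fun i => some (b i) := funext hb
    obtain rfl : f3 = fun i => some (c i) := funext hc
    simp only [branchOpt, Option.isSome_some, implies_true, dif_pos, Option.get_some]
    constructor
    intro p
    cases p with
    | nil => exact .some _ _ _ (.branch k)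
    | cons i p =>
      by_cases hi : i < k
      · simp only [branchTree, hi, dif_pos]
        exact hr _ p
      · simp only [branchTree, hi, dif_neg, not_false_eq_true]
        exact .none
  · have e : ∀ i, ((f1 i).isSome ↔ (f2 i).isSome) ∧ ((f1 i).isSome ↔ (f3 i).isSome) := by
      intro i
      have h1 := h i
      revert h1
      generalize f1 i = x
      generalize f2 i = y
      generalize f3 i = z
      intro h1
      cases h1 <;> simp
    have hs2 : ¬ ∀ i, (f2 i).isSome := fun hh => hs fun i => (e i).1.2 (hh i)
    have hs3 : ¬ ∀ i, (f3 i).isSome := fun hh => hs fun i => (e i).2.2 (hh i)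
    unfold branchOpt
    rw [dif_neg hs, dif_neg hs2, dif_neg hs3]
    exact .none

theorem semN_rel {Qubit Var : Type} (n : ℕ) : ∀ (cs : List (Cmd Qubit Var)) (Q : Finset Qubit)
    (v w : Vec Q) (S : Store Var ℕ),
    O3 TR (semN n cs ⟨Q, v⟩ S) (semN n cs ⟨Q, w⟩ S) (semN n cs ⟨Q, vadd v w⟩ S) := by
  induction n with
  | zero =>
    intro cs Q v w S
    simp only [semN]
    constructor
    intro p
    unfold nilTree
    split_ifs
    · exact .some _ _ _ .nil
    · exact .none
  | succ n ih =>
    intro cs Q v w S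
    cases cs with
    | nil =>
      simp only [semN]
      constructor
      intro p
      unfold leafTree
      split_ifs
      · exact .some _ _ _ (.leaf _ _ _ (radd_same v w S))
      · exact .none
    | cons c cs =>
      cases c with
      | skip => simp only [semN]; exact ih _ _ _ _ _
      | seq c c' => simp only [semN]; exact ih _ _ _ _ _
      | ite e c1 c0 =>
        simp only [semN]
        split
        · exact ih _ _ _ _ _
        · exact ih _ _ _ _ _
        · exact .none
      | whileC e c => simp only [semN]; exact ih _ _ _ _ _
      | assign x e =>
        simp only [semN]
        split
        · exact ih _ _ _ _ _
        · exact .none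
      | unitary k U qs =>
        simp only [semN]
        rcases applyOp_add U.mat qs v w with ⟨h1, h2, h3⟩ | ⟨v', w', h1, h2, h3⟩
        · rw [h1, h2, h3]; exact .none
        · rw [h1, h2, h3]; exact ih _ _ _ _ _
      | measure x k nq M qs =>
        simp only [semN]
        split
        · apply branchOpt_rel
          intro i
          rcases applyOp_add (M.ops i) qs v w with ⟨h1, h2, h3⟩ | ⟨v', w', h1, h2, h3⟩
          · rw [h1, h2, h3]; exact .none
          · rw [h1, h2, h3]; exact ih _ _ _ _ _
        · exact .none

/-- Limit of a sequence of trees, as in `sem`. -/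
def limTree {Qubit Var : Type} (T : ℕ → BTree Qubit Var) : BTree Qubit Var := fun p =>
  if h1 : ∃ n l, T n p = some l ∧ l ≠ BLabel.nil then some h1.choose_spec.choose
  else if ∃ n, T n p = some BLabel.nil then some BLabel.nil
  else none

theorem sem_eq {Qubit Var : Type} (cs : List (Cmd Qubit Var)) (ψ : QState Qubit) (S : Store Var ℕ)
    (T : ℕ → BTree Qubit Var) (hT : ∀ n, semN n cs ψ S = some (T n)) :
    sem cs ψ S = some (limTree T) := by
  have h : ∀ n, (semN n cs ψ S).isSome := fun n => by rw [hT]; rfl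
  obtain rfl : T = fun n => (semN n cs ψ S).get (h n) := by
    funext n
    simp only [hT, Option.get_some]
  unfold sem
  rw [dif_pos h]
  rfl

theorem limTree_rel {Qubit Var : Type} (T1 T2 T3 : ℕ → BTree Qubit Var)
    (h : ∀ n, TR (T1 n) (T2 n) (T3 n)) : TR (limTree T1) (limTree T2) (limTree T3) := by
  intro p
  have e : ∀ n, ((∃ l, T1 n p = some l ∧ l ≠ BLabel.nil) ↔ (∃ l, T2 n p = some l ∧ l ≠ BLabel.nil))
      ∧ ((∃ l, T1 n p = some l ∧ l ≠ BLabel.nil) ↔ (∃ l, T3 n p = some l ∧ l ≠ BLabel.nil))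
      ∧ (T1 n p = some .nil ↔ T2 n p = some .nil) ∧ (T1 n p = some .nil ↔ T3 n p = some .nil) := by
    intro n
    have := h n p
    revert this
    generalize T1 n p = x
    generalize T2 n p = y
    generalize T3 n p = z
    intro h
    cases h with
    | none => simp
    | some a b c h => cases h <;> simp
  have e2 : (fun n => ∃ l, T2 n p = some l ∧ l ≠ BLabel.nil) =
    (fun n => ∃ l, T1 n p = some l ∧ l ≠ BLabel.nil) := funext fun n => propext (e n).1.symm
  have e3 : (fun n => ∃ l, T3 n p = some l ∧ l ≠ BLabel.nil) =
    (fun n => ∃ l, T1 n p = some l ∧ l ≠ BLabel.nil) := funext fun n => propext (e n).2.1.symm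
  by_cases h1 : ∃ n l, T1 n p = some l ∧ l ≠ BLabel.nil
  · have h2 : ∃ n l, T2 n p = some l ∧ l ≠ BLabel.nil := by
      obtain ⟨n, hn⟩ := h1; exact ⟨n, (e n).1.1 hn⟩
    have h3 : ∃ n l, T3 n p = some l ∧ l ≠ BLabel.nil := by
      obtain ⟨n, hn⟩ := h1; exact ⟨n, (e n).2.1.1 hn⟩
    have c2 : h2.choose = h1.choose := by congr 1
    have c3 : h3.choose = h1.choose := by congr 1
    have r1 : limTree T1 p = T1 h1.choose p :=
      (dif_pos h1).trans h1.choose_spec.choose_spec.1.symm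
    have r2 : limTree T2 p = T2 h1.choose p := by
      rw [← c2]; exact (dif_pos h2).trans h2.choose_spec.choose_spec.1.symm
    have r3 : limTree T3 p = T3 h1.choose p := by
      rw [← c3]; exact (dif_pos h3).trans h3.choose_spec.choose_spec.1.symm
    rw [r1, r2, r3]
    exact h _ p
  · have h2 : ¬ ∃ n l, T2 n p = some l ∧ l ≠ BLabel.nil := by
      rintro ⟨n, hn⟩; exact h1 ⟨n, (e n).1.2 hn⟩
    have h3 : ¬ ∃ n l, T3 n p = some l ∧ l ≠ BLabel.nil := by
      rintro ⟨n, hn⟩; exact h1 ⟨n, (e n).2.1.2 hn⟩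
    have r2 : (∃ n, T2 n p = some BLabel.nil) ↔ ∃ n, T1 n p = some BLabel.nil :=
      exists_congr fun n => (e n).2.2.1.symm
    have r3 : (∃ n, T3 n p = some BLabel.nil) ↔ ∃ n, T1 n p = some BLabel.nil :=
      exists_congr fun n => (e n).2.2.2.symm
    unfold limTree
    rw [dif_neg h1, dif_neg h2, dif_neg h3]
    simp only [r2, r3]
    split_ifs
    · exact .some _ _ _ .nil
    · exact .none

theorem sem_rel {Qubit Var : Type} (cs : List (Cmd Qubit Var)) {a b c : Res Qubit Var ℕ}
    (hr : radd a b = some c) (hd : (sem cs a.1 a.2).isSome) :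
    ∃ t1 t2 t3, sem cs a.1 a.2 = some t1 ∧ sem cs b.1 b.2 = some t2 ∧ sem cs c.1 c.2 = some t3 ∧
      TR t1 t2 t3 := by
  obtain ⟨Q, v, w, S, rfl, rfl, rfl⟩ := radd_inv hr
  have hn : ∀ n, (semN n cs ⟨Q, v⟩ S).isSome := by
    by_contra hh
    unfold sem at hd
    rw [dif_neg hh] at hd
    cases hd
  have key : ∀ n, ∃ a b c, semN n cs ⟨Q, v⟩ S = some a ∧ semN n cs ⟨Q, w⟩ S = some b ∧
      semN n cs ⟨Q, vadd v w⟩ S = some c ∧ TR a b c := by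
    intro n
    have h1 := semN_rel n cs Q v w S
    have h2 := hn n
    revert h1 h2
    generalize semN n cs ⟨Q, v⟩ S = x
    generalize semN n cs ⟨Q, w⟩ S = y
    generalize semN n cs ⟨Q, vadd v w⟩ S = z
    intro h1 h2
    cases h1 with
    | none => simp at h2
    | some a b c h => exact ⟨a, b, c, rfl, rfl, rfl, h⟩
  choose A B C hA hB hC hT using key
  exact ⟨_, _, _, sem_eq _ _ _ A hA, sem_eq _ _ _ B hB, sem_eq _ _ _ C hC, limTree_rel _ _ _ hT⟩

theorem out_mk {A : Type} (I : Type) (f : I → A) :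
    ∃ e : (MSet.mk I f).out.idx ≃ I, ∀ i, (MSet.mk I f).out.val i = f (e i) := by
  have := Quotient.mk_out (s := msetSetoid A) ⟨I, f⟩
  exact this

theorem mk_eq {A I J : Type} (f : I → A) (g : J → A) (e : I ≃ J) (h : ∀ i, f i = g (e i)) :
    MSet.mk I f = MSet.mk J g :=
  Quotient.sound (s := msetSetoid A) ⟨e, h⟩

theorem biguplus_mk {A I J : Type} (K : J → Type) (g : ∀ j, K j → A) (e : I ≃ J)
    (F : I → MSet A) (hF : ∀ i, F i = MSet.mk (K (e i)) (g (e i))) :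
    MSet.biguplus I F = MSet.mk (Σ j, K j) (fun x => g x.1 x.2) := by
  obtain rfl : F = fun i => MSet.mk (K (e i)) (g (e i)) := funext hF
  choose e' he' using fun i => out_mk (K (e i)) (g (e i))
  refine mk_eq _ _ ((Equiv.sigmaCongrRight e').trans (Equiv.sigmaCongrLeft (β := K) e)) ?_
  rintro ⟨i, k⟩
  exact he' i k

theorem msem_mk {Qubit Var : Type} (C : Cmd Qubit Var) (I : Type) (f : I → Res Qubit Var ℕ)
    (T : I → BTree Qubit Var) (hT : ∀ i, sem [C] (f i).1 (f i).2 = some (T i))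
    (D : I → List ℕ → Prop) (hD : ∀ i p, D i p ↔ ∃ a, T i p = some (BLabel.leaf a))
    (g : ∀ i, {p // D i p} → Res Qubit Var ℕ)
    (hg : ∀ i (p : {p // D i p}), T i p.1 = some (BLabel.leaf (g i p))) :
    msem C (MSet.mk I f) = some (MSet.mk (Σ i, {p // D i p}) (fun x => g x.1 x.2)) := by
  obtain rfl : D = fun i p => ∃ a, T i p = some (BLabel.leaf a) :=
    funext fun i => funext fun p => propext (hD i p)
  obtain ⟨e, he⟩ := out_mk I f
  have hT' : ∀ i, sem [C] ((MSet.mk I f).out.val i).1 ((MSet.mk I f).out.val i).2 =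
    some (T (e i)) := fun i => by rw [he]; exact hT _
  have hs : ∀ i, (sem [C] ((MSet.mk I f).out.val i).1 ((MSet.mk I f).out.val i).2).isSome :=
    fun i => by rw [hT']; rfl
  unfold msem
  rw [dif_pos hs]
  congr 1
  refine biguplus_mk (fun i => {p // ∃ a, T i p = some (BLabel.leaf a)}) g e _ ?_
  intro i
  simp only [hT', Option.get_some]
  unfold Leaves
  congr 1
  funext p
  have := p.2.choose_spec.symm.trans (hg _ p)
  exact BLabel.leaf.inj (Option.some.inj this)

theorem msem_def {Qubit Var : Type} (C : Cmd Qubit Var) (I : Type) (f : I → Res Qubit Var ℕ)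
    {m'} (h : msem C (MSet.mk I f) = some m') (i : I) : (sem [C] (f i).1 (f i).2).isSome := by
  obtain ⟨e, he⟩ := out_mk I f
  have hs : ∀ i, (sem [C] ((MSet.mk I f).out.val i).1 ((MSet.mk I f).out.val i).2).isSome := by
    by_contra hn
    unfold msem at h
    rw [dif_neg hn] at h
    cases h
  have := hs (e.symm i)
  rwa [he, Equiv.apply_symm_apply] at this

theorem propSum_intro {Qubit Var Val J : Type} (g1 g2 g3 : J → Res Qubit Var Val)
    (hr : ∀ j, radd (g1 j) (g2 j) = some (g3 j)) {Q Q' : SLProp Qubit Var Val}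
    (h1 : MSet.mk J g1 ∈ Q) (h2 : MSet.mk J g2 ∈ Q') : MSet.mk J g3 ∈ propSum Q Q' := by
  obtain ⟨e, he⟩ := out_mk J (fun j => (g1 j, g2 j))
  refine ⟨MSet.mk J (fun j => (g1 j, g2 j)), ?_, ?_, ?_⟩
  · convert h1 using 1
    exact mk_eq _ _ e fun i => by rw [he]
  · convert h2 using 1
    exact mk_eq _ _ e fun i => by rw [he]
  · have hr' : ∀ i, radd ((MSet.mk J (fun j => (g1 j, g2 j))).out.val i).1
        ((MSet.mk J (fun j => (g1 j, g2 j))).out.val i).2 = some (g3 (e i)) := fun i => by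
      rw [he]; exact hr _
    unfold msumr
    rw [dif_pos (fun i => by rw [hr']; rfl)]
    congr 1
    refine mk_eq _ _ e fun i => ?_
    simp only [hr', Option.get_some]

/-- Soundness of the sum rule for Hoare triples. -/
theorem hoare_sum {Qubit Var : Type} (C : Cmd Qubit Var)
    (P P' Q Q' : SLProp Qubit Var ℕ)
    (h : hoare P C Q) (h' : hoare P' C Q') :
    hoare (propSum P P') C (propSum Q Q') := by
  rintro m ⟨r, hP, hP', hm⟩
  have hs : ∀ i, (radd (r.out.val i).1 (r.out.val i).2).isSome := by
    by_contra hn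
    unfold msumr at hm
    rw [dif_neg hn] at hm
    cases hm
  unfold msumr at hm
  rw [dif_pos hs] at hm
  obtain rfl := Option.some.inj hm
  obtain ⟨m1, hm1, hQ⟩ := h _ hP
  obtain ⟨m2, hm2, hQ'⟩ := h' _ hP'
  have hd := msem_def C _ _ hm1
  have key := fun i => sem_rel [C] (Option.some_get (hs i)).symm (hd i)
  choose T1 T2 T3 h1 h2 h3 hT using key
  have key2 : ∀ i (p : {p // ∃ a, T1 i p = some (BLabel.leaf a)}), ∃ a b c,
      T1 i p.1 = some (.leaf a) ∧ T2 i p.1 = some (.leaf b) ∧ T3 i p.1 = some (.leaf c) ∧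
      radd a b = some c := by
    rintro i ⟨p, a, ha⟩
    have := hT i p
    revert this ha
    dsimp only
    generalize T1 i p = x
    generalize T2 i p = y
    generalize T3 i p = z
    intro ha hx
    cases hx with
    | none => cases ha
    | some x y z hl =>
      cases hl with
      | branch k => cases ha
      | nil => cases ha
      | leaf a b c hh => exact ⟨a, b, c, rfl, rfl, rfl, hh⟩
  have key3 : ∀ i p, ((∃ a, T1 i p = some (BLabel.leaf a)) ↔ ∃ a, T2 i p = some (BLabel.leaf a)) ∧
      ((∃ a, T1 i p = some (BLabel.leaf a)) ↔ ∃ a, T3 i p = some (BLabel.leaf a)) := by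
    intro i p
    have := hT i p
    revert this
    generalize T1 i p = x
    generalize T2 i p = y
    generalize T3 i p = z
    intro hx
    cases hx with
    | none => simp
    | some x y z hl => cases hl <;> simp
  choose g1 g2 g3 hg1 hg2 hg3 hg using key2
  have e1 := msem_mk C _ _ T1 h1 _ (fun i p => Iff.rfl) g1 hg1
  have e2 := msem_mk C _ _ T2 h2 _ (fun i p => (key3 i p).1) g2 hg2
  have e3 := msem_mk C _ _ T3 h3 _ (fun i p => (key3 i p).2) g3 hg3
  refine ⟨_, e3, ?_⟩
  obtain rfl := Option.some.inj (hm1.symm.trans e1)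
  obtain rfl := Option.some.inj (hm2.symm.trans e2)
  refine propSum_intro _ _ _ ?_ hQ hQ'
  exact fun j => hg j.1 j.2
end QSL
end
end
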